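/- Let p1, p2 ∈ SL(2,ℝ) be parabolic, z1, z2 ∈ ℍ, and a, b ≥ 0 with a + b > 0. Then for t ∈ ℝ, the family n ↦ exp(−t·(a·dist(z1, p1ⁿ·z1) + b·dist(z2, p2ⁿ·z2))), indexed by n ∈ ℤ, is summable if and only if t > 1/(2(a+b)). In particular, the critical exponent of the weighted Poincaré series of the cyclic group generated by a parabolic element equals 1/(2(a+b)). -/

import Mathlib

open scoped MatrixGroups UpperHalfPlane

/-- An element of `SL(2,ℝ)` is parabolic if its trace squared is 4 and it is not `±I`. -/
def IsParabolic (p : SL(2, ℝ)) : Prop :=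
  (Matrix.trace (p : Matrix (Fin 2) (Fin 2) ℝ)) ^ 2 = 4 ∧
    (p : Matrix (Fin 2) (Fin 2) ℝ) ≠ 1 ∧ (p : Matrix (Fin 2) (Fin 2) ℝ) ≠ -1

lemma sinh_half_smul (g : SL(2, ℝ)) (z : ℍ) :
    Real.sinh (dist z (g • z) / 2) =
      ‖(g 1 0 : ℂ) * z ^ 2 + ((g 1 1 : ℂ) - (g 0 0 : ℂ)) * z - (g 0 1 : ℂ)‖ / (2 * z.im) := by
  have hd : ((g 1 0 : ℂ) * z + (g 1 1 : ℂ)) ≠ 0 := by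
    simpa [UpperHalfPlane.denom] using UpperHalfPlane.denom_ne_zero (g : GL (Fin 2) ℝ) z
  have hdet : g 0 0 * g 1 1 - g 0 1 * g 1 0 = 1 := by
    have := g.det_coe
    rwa [Matrix.det_fin_two] at this
  have hco : ((g • z : ℍ) : ℂ) = ((g 0 0 : ℂ) * z + g 0 1) / ((g 1 0 : ℂ) * z + g 1 1) := by
    simpa using UpperHalfPlane.coe_specialLinearGroup_apply (g) z
  have him : (g • z : ℍ).im = z.im / ‖(g 1 0 : ℂ) * z + (g 1 1 : ℂ)‖ ^ 2 := by
    rw [← UpperHalfPlane.coe_im, hco, Complex.div_im, ← Complex.normSq_eq_norm_sq]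
    rw [← sub_div]
    congr 1
    simp
    linear_combination z.im * hdet
  have hn : 0 < ‖(g 1 0 : ℂ) * z + (g 1 1 : ℂ)‖ := norm_pos_iff.2 hd
  have hz := z.im_pos
  have hs : √(z.im * (g • z : ℍ).im) = z.im / ‖(g 1 0 : ℂ) * z + (g 1 1 : ℂ)‖ := by
    rw [him, Real.sqrt_eq_iff_mul_self_eq (by positivity) (by positivity)]
    field_simp
  have hdist : dist (z : ℂ) (g • z : ℍ) =
      ‖(g 1 0 : ℂ) * z ^ 2 + ((g 1 1 : ℂ) - (g 0 0 : ℂ)) * z - (g 0 1 : ℂ)‖ /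
        ‖(g 1 0 : ℂ) * z + (g 1 1 : ℂ)‖ := by
    rw [dist_eq_norm, hco, ← norm_div]
    congr 1
    rw [eq_div_iff hd, sub_mul, div_mul_cancel₀ _ hd]
    ring
  rw [UpperHalfPlane.sinh_half_dist, hs, hdist]
  field_simp

lemma pow_entries (p : SL(2, ℝ)) (e : ℝ) (he : e ^ 2 = 1) (htr : p 0 0 + p 1 1 = 2 * e) (n : ℕ) :
    ∃ s : ℝ, |s| = 1 ∧ (p ^ n) 0 0 = s * (1 + n * (e * p 0 0 - 1)) ∧
      (p ^ n) 0 1 = s * (n * (e * p 0 1)) ∧ (p ^ n) 1 0 = s * (n * (e * p 1 0)) ∧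
      (p ^ n) 1 1 = s * (1 + n * (e * p 1 1 - 1)) := by
  have hdet : p 0 0 * p 1 1 - p 0 1 * p 1 0 = 1 := by
    have := p.det_coe
    rwa [Matrix.det_fin_two] at this
  have hee : |e| = 1 := by
    rcases sq_eq_one_iff.1 he with h | h <;> simp [h]
  induction n with
  | zero => exact ⟨1, by simp⟩
  | succ n ih =>
    obtain ⟨s, hs, h1, h2, h3, h4⟩ := ih
    have hd : p 1 1 = 2 * e - p 0 0 := by linarith
    have hbc : p 0 1 * p 1 0 = p 0 0 * (2 * e - p 0 0) - 1 := by rw [← hd]; linarith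
    refine ⟨s * e, by rw [abs_mul, hs, hee, one_mul], ?_, ?_, ?_, ?_⟩ <;>
      rw [pow_succ, Matrix.SpecialLinearGroup.coe_mul, Matrix.mul_apply, Fin.sum_univ_two] <;>
      simp only [h1, h2, h3, h4, hd] <;> push_cast
    · linear_combination s * n * e * hbc + s * p 0 0 * (n - 1) * he
    · linear_combination s * p 0 1 * (n - 1) * he
    · linear_combination s * p 1 0 * (n - 1) * he
    · linear_combination s * n * e * hbc + s * (2 * e - p 0 0) * (n - 1) * he

lemma parabolic_sinh (p : SL(2, ℝ)) (hp : IsParabolic p) (z : ℍ) :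
    ∃ c : ℝ, 0 < c ∧ ∀ n : ℤ, Real.sinh (dist z (p ^ n • z) / 2) = c * |(n : ℝ)| := by
  obtain ⟨htr, hp1, hp2⟩ := hp
  have hdet : p 0 0 * p 1 1 - p 0 1 * p 1 0 = 1 := by
    have := p.det_coe
    rwa [Matrix.det_fin_two] at this
  rw [Matrix.trace_fin_two] at htr
  obtain ⟨e, he, he2⟩ : ∃ e : ℝ, e ^ 2 = 1 ∧ p 0 0 + p 1 1 = 2 * e :=
    ⟨(p 0 0 + p 1 1) / 2, by linear_combination htr / 4, by ring⟩
  have hee : |e| = 1 := by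
    rcases sq_eq_one_iff.1 he with h | h <;> simp [h]
  have hz := z.im_pos
  set Q : ℂ := (p 1 0 : ℂ) * z ^ 2 + ((p 1 1 : ℂ) - (p 0 0 : ℂ)) * z - (p 0 1 : ℂ) with hQ
  have hQ0 : Q ≠ 0 := by
    intro h
    have h4 : (2 * (p 1 0 : ℂ) * z + (p 1 1 - p 0 0)) ^ 2 = 0 := by
      have : ((p 1 1 : ℂ) - p 0 0) ^ 2 + 4 * (p 1 0) * p 0 1 = 0 := by
        have : (p 1 1 - p 0 0) ^ 2 + 4 * (p 1 0) * p 0 1 = 0 := by linear_combination htr - 4 * hdet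
        exact_mod_cast this
      linear_combination 4 * (p 1 0 : ℂ) * h + this
    have h5 := pow_eq_zero_iff (two_ne_zero) |>.1 h4
    have hc : p 1 0 = 0 := by
      have := congrArg Complex.im h5
      simpa [hz.ne'] using this
    have hda : p 1 1 = p 0 0 := by
      have := congrArg Complex.re h5
      simp [hc] at this
      linarith
    have hb : p 0 1 = 0 := by
      rw [hQ] at h
      simpa [hc, hda] using h
    have ha : p 0 0 = e := by linarith
    rcases sq_eq_one_iff.1 he with h | h
    · apply hp1
      ext i j
      fin_cases i <;> fin_cases j <;> simp [hc, hda, hb, ha, h]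
    · apply hp2
      ext i j
      fin_cases i <;> fin_cases j <;> simp [hc, hda, hb, ha, h]
  refine ⟨‖Q‖ / (2 * z.im), by positivity, ?_⟩
  have key : ∀ n : ℕ, Real.sinh (dist z (p ^ n • z) / 2) = ‖Q‖ / (2 * z.im) * n := by
    intro n
    obtain ⟨s, hs, h1, h2, h3, h4⟩ := pow_entries p e he he2 n
    rw [sinh_half_smul, h1, h2, h3, h4]
    have : ((s * (n * (e * p 1 0)) : ℝ) : ℂ) * z ^ 2 +
        (((s * (1 + n * (e * p 1 1 - 1)) : ℝ) : ℂ) - ((s * (1 + n * (e * p 0 0 - 1)) : ℝ) : ℂ)) * z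
        - ((s * (n * (e * p 0 1)) : ℝ) : ℂ) = (s : ℂ) * (e : ℂ) * n * Q := by
      rw [hQ]; push_cast; ring
    rw [this]
    simp [hs, hee]
    ring
  intro n
  obtain ⟨m, rfl | rfl⟩ := n.eq_nat_or_neg
  · simpa using key m
  · have : dist z (p ^ (-(m : ℤ)) • z) = dist z (p ^ m • z) := by
      rw [zpow_neg, zpow_natCast, ← dist_smul (p ^ m), smul_inv_smul, dist_comm]
    rw [this]
    simpa using key m

lemma parabolic_bound (p : SL(2, ℝ)) (hp : IsParabolic p) (z : ℍ) :
    ∃ K : ℝ, ∀ n : ℤ, n ≠ 0 → |dist z (p ^ n • z) - 2 * Real.log (|(n : ℝ)|)| ≤ K := by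
  obtain ⟨c, hc, h⟩ := parabolic_sinh p hp z
  refine ⟨max (-(2 * Real.log (2 * c))) (2 * Real.log (2 * c + 1)), fun n hn => ?_⟩
  have hn1 : (1 : ℝ) ≤ |(n : ℝ)| := by exact_mod_cast Int.one_le_abs hn
  have hn0 : 0 < |(n : ℝ)| := by linarith
  have h := h n
  set d := dist z (p ^ n • z)
  have hd : 0 ≤ d := dist_nonneg
  rw [Real.sinh_eq] at h
  have e0 : 0 < Real.exp (-(d / 2)) := Real.exp_pos _
  have e1 : Real.exp (-(d / 2)) ≤ 1 := Real.exp_le_one_iff.2 (by linarith)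
  have l1 : Real.log (2 * c * |(n : ℝ)|) ≤ d / 2 := by
    rw [Real.log_le_iff_le_exp (by positivity)]; linarith
  have l2 : d / 2 ≤ Real.log ((2 * c + 1) * |(n : ℝ)|) := by
    rw [Real.le_log_iff_exp_le (by positivity)]; nlinarith
  rw [Real.log_mul (by positivity) hn0.ne'] at l1 l2
  rw [abs_le]
  constructor
  · have := le_max_left (-(2 * Real.log (2 * c))) (2 * Real.log (2 * c + 1)); linarith
  · have := le_max_right (-(2 * Real.log (2 * c))) (2 * Real.log (2 * c + 1)); linarith

/-- The critical exponent of the weighted Poincaré series of the cyclic group generated by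
a parabolic element equals `1/(2(a+b))`. -/
theorem parabolic_weighted_critical_exponent (p1 p2 : SL(2, ℝ))
    (hp1 : IsParabolic p1) (hp2 : IsParabolic p2) (z1 z2 : ℍ)
    (a b : ℝ) (ha : 0 ≤ a) (hb : 0 ≤ b) (hab : 0 < a + b) (t : ℝ) :
    (Summable fun n : ℤ => Real.exp
        (-t * (a * dist z1 (p1 ^ n • z1) + b * dist z2 (p2 ^ n • z2))))
      ↔ 1 / (2 * (a + b)) < t := by
  obtain ⟨K1, h1⟩ := parabolic_bound p1 hp1 z1
  obtain ⟨K2, h2⟩ := parabolic_bound p2 hp2 z2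
  set W : ℤ → ℝ := fun n => a * dist z1 (p1 ^ n • z1) + b * dist z2 (p2 ^ n • z2) with hW
  set s := 2 * (a + b) * t with hs
  obtain ⟨M, hM⟩ : ∃ M : ℝ, ∀ n : ℤ, n ≠ 0 → |t * W n - s * Real.log (|(n : ℝ)|)| ≤ M := by
    refine ⟨|t| * (a * K1 + b * K2), fun n hn => ?_⟩
    have : t * W n - s * Real.log (|(n : ℝ)|) = t * (a * (dist z1 (p1 ^ n • z1) - 2 * Real.log (|(n : ℝ)|))
      + b * (dist z2 (p2 ^ n • z2) - 2 * Real.log (|(n : ℝ)|))) := by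
      simp only [hW, hs]; ring
    rw [this, abs_mul]
    gcongr
    refine (abs_add_le _ _).trans ?_
    rw [abs_mul, abs_mul, abs_of_nonneg ha, abs_of_nonneg hb]
    gcongr
    · exact h1 n hn
    · exact h2 n hn
  have hst : 1 / (2 * (a + b)) < t ↔ 1 < s := by
    rw [div_lt_iff₀ (by positivity), hs, mul_comm t]
  have hpow : ∀ n : ℤ, n ≠ 0 → |(n : ℝ)| ^ (-s) = Real.exp (-s * Real.log (|(n : ℝ)|)) := by
    intro n hn
    rw [Real.rpow_def_of_pos (by positivity), mul_comm]
  rw [hst]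
  constructor
  · intro h
    have h' : Summable fun n : ℕ => Real.exp M * Real.exp (-t * W n) :=
      (h.comp_injective Nat.cast_injective).mul_left (Real.exp M)
    have h3 : Summable fun n : ℕ => (n : ℝ) ^ (-s) := by
      refine Summable.of_norm_bounded_eventually h' ?_
      rw [Nat.cofinite_eq_atTop]
      filter_upwards [Filter.eventually_ne_atTop 0] with n hn
      have hn' : (n : ℤ) ≠ 0 := by exact_mod_cast hn
      have e := hpow n hn'
      have m := abs_le.1 (hM n hn')
      rw [Real.norm_of_nonneg (by positivity), ← Real.exp_add]
      simp only [Int.cast_natCast, Nat.abs_cast] at e m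
      rw [e]
      apply Real.exp_le_exp.2
      linarith [m.2]
    rw [Real.summable_nat_rpow] at h3
    linarith
  · intro h
    have h3 := (Real.summable_abs_int_rpow h).mul_left (Real.exp M)
    refine Summable.of_norm_bounded_eventually h3 ?_
    have : ∀ᶠ n : ℤ in Filter.cofinite, n ≠ 0 := by
      rw [Filter.eventually_cofinite]
      simp
    filter_upwards [this] with n hn
    have m := abs_le.1 (hM n hn)
    rw [Real.norm_of_nonneg (by positivity), hpow n hn, ← Real.exp_add]
    apply Real.exp_le_exp.2
    linarith [m.1]
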